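/- arXiv:2207.13041 — 5 statements merged into one kernel-verified Lean document; each statement's English description precedes it below -/
import Mathlib

section
/- For every integer n ≥ 1 and every preference list α ∈ [n]^n, α is a classical parking function of length n if and only if α is an MVP parking function of length n (i.e., PF_n = MVP_n as sets). -/
open Finset

namespace MVPPark

/-- One step of the MVP parking process: car `c`, preferring spot `p`, arrives at the
state `state` (recording, for each spot, the car parked there, if any).  Car `c` always
parks in spot `p`; if spot `p` was occupied by an (earlier) car `j`, then `j` is bumped
and parks in the first unoccupied spot strictly beyond `p`, if such a spot exists
(otherwise `j` drives off unparked). -/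
def mvpStep {n : ℕ} (state : Fin n → Option (Fin n)) (c p : Fin n) :
    Fin n → Option (Fin n) :=
  match state p with
  | none => Function.update state p (some c)
  | some j =>
    match (List.finRange n).find? (fun k => decide (p < k) && (state k).isNone) with
    | none => Function.update state p (some c)
    | some k => Function.update (Function.update state p (some c)) k (some j)

/-- The final state of the MVP parking process with preference list `α`:
cars `0, 1, …, n-1` enter in order, car `i` preferring spot `α i`. -/
def mvpRun {n : ℕ} (α : Fin n → Fin n) : Fin n → Option (Fin n) :=
  (List.finRange n).foldl (fun st c => mvpStep st c (α c)) (fun _ => none)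

/-- `α` is an MVP parking function: under the MVP rule, all `n` cars end up parked. -/
def IsMVP {n : ℕ} (α : Fin n → Fin n) : Prop :=
  ∀ c : Fin n, ∃ j : Fin n, mvpRun α j = some c

/-- The outcome of the MVP parking process on `α` is the permutation `π`:
for each `j`, spot `j` ends up occupied by car `π j`. -/
def MvpOutcome {n : ℕ} (α : Fin n → Fin n) (π : Equiv.Perm (Fin n)) : Prop :=
  ∀ j : Fin n, mvpRun α j = some (π j)

end MVPPark

namespace MVPPark

/-- One step of the classical parking process: car `c`, preferring spot `p`, drives
forward from spot `p` and parks in the first unoccupied spot `k ≥ p`, if such a spot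
exists (otherwise it drives off unparked). -/
def pfStep {n : ℕ} (state : Fin n → Option (Fin n)) (c p : Fin n) :
    Fin n → Option (Fin n) :=
  match (List.finRange n).find? (fun k => decide (p ≤ k) && (state k).isNone) with
  | none => state
  | some k => Function.update state k (some c)

/-- The final state of the classical parking process with preference list `α`. -/
def pfRun {n : ℕ} (α : Fin n → Fin n) : Fin n → Option (Fin n) :=
  (List.finRange n).foldl (fun st c => pfStep st c (α c)) (fun _ => none)

/-- `α` is a classical parking function: all `n` cars end up parked. -/
def IsPF {n : ℕ} (α : Fin n → Fin n) : Prop :=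
  ∀ c : Fin n, ∃ j : Fin n, pfRun α j = some c

end MVPPark

namespace MVPPark

variable {n : ℕ}

/-- No car occupies two different spots of `st`. -/
def NoRepeat (st : Fin n → Option (Fin n)) : Prop :=
  ∀ i j c, st i = some c → st j = some c → i = j

/-- A parking rule adds only the arriving car, and keeps each car in at most one spot when the
arriving car is new. -/
def IsParkingRule (step : (Fin n → Option (Fin n)) → Fin n → Fin n → Fin n → Option (Fin n)) :
    Prop :=
  ∀ st c p, (∀ j d, step st c p j = some d → d = c ∨ ∃ i, st i = some d) ∧
    (NoRepeat st → (∀ i, st i ≠ some c) → NoRepeat (step st c p))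

theorem isParkingRule_pfStep : IsParkingRule (pfStep (n := n)) := by
  intro st c p
  cases hk : (List.finRange n).find? (fun k => decide (p ≤ k) && (st k).isNone) <;>
    simp only [pfStep, hk, NoRepeat, Function.update_apply] <;> grind

theorem isParkingRule_mvpStep : IsParkingRule (mvpStep (n := n)) := by
  intro st c p
  cases hp : st p <;>
    cases hk : (List.finRange n).find? (fun k => decide (p < k) && (st k).isNone) <;>
    simp only [mvpStep, hp, hk, NoRepeat, Function.update_apply] <;> grind

/-- Letting distinct new cars in by a parking rule never puts a car in two spots. -/
theorem IsParkingRule.noRepeat_foldl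
    {step : (Fin n → Option (Fin n)) → Fin n → Fin n → Fin n → Option (Fin n)}
    (hstep : IsParkingRule step) (α : Fin n → Fin n) {l : List (Fin n)} (hl : l.Nodup)
    {st : Fin n → Option (Fin n)} (hst : NoRepeat st) (hnew : ∀ c ∈ l, ∀ i, st i ≠ some c) :
    NoRepeat (l.foldl (fun st c => step st c (α c)) st) := by
  induction l generalizing st with
  | nil => exact hst
  | cons c l ih =>
    obtain ⟨hval, hrep⟩ := hstep st c (α c)
    rw [List.nodup_cons] at hl
    refine ih hl.2 (hrep hst (hnew c List.mem_cons_self)) fun d hd i hi => ?_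
    rcases hval i d hi with rfl | ⟨k, hk⟩
    · exact hl.1 hd
    · exact hnew d (List.mem_cons_of_mem c hd) k hk

theorem IsParkingRule.noRepeat_run
    {step : (Fin n → Option (Fin n)) → Fin n → Fin n → Fin n → Option (Fin n)}
    (hstep : IsParkingRule step) (α : Fin n → Fin n) :
    NoRepeat ((List.finRange n).foldl (fun st c => step st c (α c)) (fun _ => none)) :=
  hstep.noRepeat_foldl α (List.nodup_finRange n) (by simp [NoRepeat]) (by simp)

/-- When no car is repeated, all cars are parked if and only if all spots are occupied. -/
theorem NoRepeat.forall_exists_eq_some_iff {st : Fin n → Option (Fin n)} (hst : NoRepeat st) :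
    (∀ c, ∃ j, st j = some c) ↔ ∀ j, (st j).isSome := by
  constructor
  · intro h
    choose f hf using h
    have hinj : Function.Injective f := fun a b hab => by
      simpa [hab, hf b] using (hf a).symm
    intro j
    obtain ⟨c, rfl⟩ := Finite.surjective_of_injective hinj j
    simp [hf c]
  · intro h
    simp only [Option.isSome_iff_exists] at h
    choose f hf using h
    have hinj : Function.Injective f := fun a b hab => hst a b (f a) (hf a) (hab ▸ hf b)
    intro c
    obtain ⟨j, rfl⟩ := Finite.surjective_of_injective hinj c
    exact ⟨j, hf j⟩

/-- From states with the same occupied spots, the two rules lead to the same occupied spots. -/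
theorem isSome_pfStep_eq_isSome_mvpStep {st st' : Fin n → Option (Fin n)}
    (h : ∀ j, (st j).isSome = (st' j).isSome) (c p j : Fin n) :
    (pfStep st c p j).isSome = (mvpStep st' c p j).isSome := by
  have hnone (k : Fin n) : (st k).isNone = (st' k).isNone := by
    simpa only [Option.not_isSome] using congrArg (! ·) (h k)
  cases hp : st' p with
  | none =>
    have hfind : (List.finRange n).find? (fun k => decide (p ≤ k) && (st k).isNone) = some p := by
      rw [List.find?_eq_some_iff_getElem]
      refine ⟨by simp [hnone, hp], p, by simp, by simp, fun i hi => ?_⟩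
      simp [Fin.le_def, hi.not_ge]
    simp only [pfStep, mvpStep, hp, hfind, Function.update_apply]
    grind
  | some d =>
    have hpred : (fun k => decide (p ≤ k) && (st k).isNone) =
        fun k => decide (p < k) && (st' k).isNone := by
      funext k
      rw [hnone]
      rcases eq_or_ne p k with rfl | hk
      · simp [hp]
      · simp [hk.le_iff_lt]
    cases hk : (List.finRange n).find? (fun k => decide (p < k) && (st' k).isNone) <;>
      simp only [pfStep, mvpStep, hp, hpred, hk, Function.update_apply] <;> grind

theorem isSome_pfRun_eq_isSome_mvpRun (α : Fin n → Fin n) (j : Fin n) :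
    (pfRun α j).isSome = (mvpRun α j).isSome := by
  have h := List.foldl_rel (l := List.finRange n) (f := fun st c => pfStep st c (α c))
    (g := fun st c => mvpStep st c (α c)) (a := fun _ => none) (b := fun _ => none)
    (r := fun st st' => ∀ j, (st j).isSome = (st' j).isSome) (fun _ => rfl)
    fun c _ _ _ h => isSome_pfStep_eq_isSome_mvpStep h c (α c)
  exact h j

end MVPPark

open MVPPark in
/-- A preference list is a classical parking function if and only if it is an MVP
parking function. -/
theorem pf_iff_mvp (n : ℕ) (hn : 1 ≤ n) (α : Fin n → Fin n) :
    IsPF α ↔ IsMVP α := by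
  have hpf : NoRepeat (pfRun α) := isParkingRule_pfStep.noRepeat_run α
  have hmvp : NoRepeat (mvpRun α) := isParkingRule_mvpStep.noRepeat_run α
  rw [IsPF, IsMVP, hpf.forall_exists_eq_some_iff, hmvp.forall_exists_eq_some_iff]
  exact forall_congr' fun j => by rw [isSome_pfRun_eq_isSome_mvpRun]
end

section
/- For every integer n ≥ 1, the number of MVP parking functions of length n is (n+1)^(n−1), i.e., |MVP_n| = (n+1)^(n−1). -/
open Finset

namespace MVPPark

/-- One step of circular parking on the spots `0, …, n`: a car preferring `a` takes the first
spot outside the occupied set `S` met when going around the circle from `a`. -/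
def circStep {n : ℕ} (S : Finset (Fin (n + 1))) (a : Fin (n + 1)) : Finset (Fin (n + 1)) :=
  if h : ∃ k, a + k ∉ S then insert (a + Fin.find (fun k => a + k ∉ S) h) S else S

/-- The spots occupied after circular parking with the preferences listed in `l`. -/
def circRun {n : ℕ} (l : List (Fin (n + 1))) : Finset (Fin (n + 1)) :=
  l.foldl circStep ∅

section Circular

variable {n : ℕ} {S T : Finset (Fin (n + 1))} {a r x : Fin (n + 1)}

lemma subset_circStep : S ⊆ circStep S a := by
  unfold circStep
  split_ifs
  · exact subset_insert _ _
  · exact Finset.Subset.rfl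

lemma self_mem_circStep : a ∈ circStep S a := by
  by_cases ha : a ∈ S
  · exact subset_circStep ha
  · have h : ∃ k, a + k ∉ S := ⟨0, by simpa using ha⟩
    have h0 : Fin.find (fun k => a + k ∉ S) h = 0 := by
      rw [Fin.find_eq_iff]
      exact ⟨by simpa using ha, fun j hj => absurd hj (Fin.not_lt_zero j)⟩
    rw [circStep, dif_pos h, h0]
    simp

lemma card_circStep (hS : S.card < n + 1) : (circStep S a).card = S.card + 1 := by
  have h : ∃ k, a + k ∉ S := by
    by_contra! h
    have : S = univ := eq_univ_of_forall fun x => by simpa using h (x - a)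
    simp [this] at hS
  rw [circStep, dif_pos h, card_insert_of_notMem (Fin.find_spec h)]

lemma add_mem_circStep (h : ∀ x, x + r ∈ T ↔ x ∈ S) (x : Fin (n + 1)) :
    x + r ∈ circStep T (a + r) ↔ x ∈ circStep S a := by
  have hk : ∀ k, a + r + k ∉ T ↔ a + k ∉ S := fun k => by rw [add_right_comm, h]
  simp only [circStep, hk]
  split_ifs
  · rw [mem_insert, mem_insert, h, add_right_comm, add_left_inj]
  · exact h x

lemma circStep_eq_insert {q : Fin (n + 1)} (haq : a ≤ q) (hq : q ∉ S)
    (hS : ∀ x, a ≤ x → x < q → x ∈ S) : circStep S a = insert q S := by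
  have h : ∃ k, a + k ∉ S := ⟨q - a, by simpa using hq⟩
  have hf : Fin.find (fun k => a + k ∉ S) h = q - a := by
    rw [Fin.find_eq_iff]
    refine ⟨by simpa using hq, fun j hj => not_not.2 ?_⟩
    have hj' : (j : ℕ) < q - a := by rwa [Fin.lt_def, Fin.sub_val_of_le haq] at hj
    have hv : ((a + j : Fin (n + 1)) : ℕ) = a + j := by
      rw [Fin.val_add, Nat.mod_eq_of_lt (by omega)]
    exact hS _ (by rw [Fin.le_def]; omega) (by rw [Fin.lt_def]; omega)
  rw [circStep, dif_pos h, hf, add_sub_cancel]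

lemma circRun_concat (l : List (Fin (n + 1))) (a : Fin (n + 1)) :
    circRun (l ++ [a]) = circStep (circRun l) a := by
  simp [circRun]

lemma card_circRun (l : List (Fin (n + 1))) (hl : l.length ≤ n + 1) :
    (circRun l).card = l.length := by
  induction l using List.reverseRecOn with
  | nil => rfl
  | append_singleton l a ih =>
    rw [List.length_append, List.length_singleton] at hl ⊢
    have := ih (by omega)
    rw [circRun_concat, card_circStep (by omega), this]

lemma mem_circRun_of_mem {l : List (Fin (n + 1))} (h : a ∈ l) : a ∈ circRun l := by
  induction l using List.reverseRecOn with
  | nil => simp at h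
  | append_singleton l b ih =>
    rw [circRun_concat]
    rcases List.mem_append.1 h with h | h
    · exact subset_circStep (ih h)
    · rw [List.mem_singleton.1 h]
      exact self_mem_circStep

lemma add_mem_circRun_map (l : List (Fin (n + 1))) (r x : Fin (n + 1)) :
    x + r ∈ circRun (l.map (· + r)) ↔ x ∈ circRun l := by
  induction l using List.reverseRecOn generalizing x with
  | nil => simp [circRun]
  | append_singleton l a ih =>
    rw [List.map_append, List.map_singleton, circRun_concat, circRun_concat]
    exact add_mem_circStep ih x

end Circular

/-- Each spot is left empty by equally many circular preference lists of length `n`. -/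
lemma card_last_notMem_circRun (n : ℕ) :
    (n + 1) * #{β : Fin n → Fin (n + 1) | Fin.last n ∉ circRun (List.ofFn β)} = (n + 1) ^ n := by
  have hshift (x : Fin (n + 1)) :
      #{β : Fin n → Fin (n + 1) | x ∉ circRun (List.ofFn β)} =
        #{β : Fin n → Fin (n + 1) | Fin.last n ∉ circRun (List.ofFn β)} := by
    refine card_equiv (Equiv.addRight fun _ => Fin.last n - x) fun β => ?_
    have hmap : List.ofFn (β + fun _ => Fin.last n - x) =
        (List.ofFn β).map (· + (Fin.last n - x)) := by
      rw [List.map_ofFn]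
      rfl
    have := add_mem_circRun_map (List.ofFn β) (Fin.last n - x) x
    rw [add_sub_cancel, ← hmap] at this
    simp [this]
  have hone (β : Fin n → Fin (n + 1)) : #{x | x ∉ circRun (List.ofFn β)} = 1 := by
    have hc := card_circRun (List.ofFn β) (by simp)
    have : ({x | x ∉ circRun (List.ofFn β)} : Finset (Fin (n + 1))) =
        (circRun (List.ofFn β))ᶜ := by
      ext
      simp
    rw [this, card_compl, hc]
    simp
  have hcount := sum_card_bipartiteAbove_eq_sum_card_bipartiteBelow
    (s := (univ : Finset (Fin (n + 1)))) (t := (univ : Finset (Fin n → Fin (n + 1))))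
    (fun x β => x ∉ circRun (List.ofFn β))
  simp only [bipartiteAbove, bipartiteBelow, hshift, hone] at hcount
  simpa using hcount

section Linear

variable {n : ℕ} {st : Fin n → Option (Fin n)} {c p : Fin n} {T : Finset (Fin (n + 1))}

lemma mvpStep_cases (st : Fin n → Option (Fin n)) (c p : Fin n) :
    (st p = none ∧ mvpStep st c p = Function.update st p (some c)) ∨
    (∃ j, st p = some j ∧ (∀ k, p < k → (st k).isSome) ∧
      mvpStep st c p = Function.update st p (some c)) ∨
    (∃ j k, st p = some j ∧ p < k ∧ st k = none ∧ (∀ y, p < y → y < k → (st y).isSome) ∧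
      mvpStep st c p = Function.update (Function.update st p (some c)) k (some j)) := by
  cases hp : st p with
  | none => exact .inl ⟨rfl, by simp [mvpStep, hp]⟩
  | some j =>
    right
    cases hk : (List.finRange n).find? (fun k => decide (p < k) && (st k).isNone) with
    | none =>
      refine .inl ⟨j, rfl, fun k hpk => ?_, by simp [mvpStep, hp, hk]⟩
      rw [List.find?_eq_none] at hk
      simpa [hpk, Option.isSome_iff_ne_none] using hk k
    | some k =>
      have hstep : mvpStep st c p = Function.update (Function.update st p (some c)) k (some j) := by
        simp [mvpStep, hp, hk]
      rw [← Fin.find?_eq_find?_finRange, Fin.find?_eq_some_iff] at hk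
      obtain ⟨hk, hmin⟩ := hk
      simp only [Bool.and_eq_true, decide_eq_true_eq, Option.isNone_iff_eq_none] at hk
      refine .inr ⟨j, k, rfl, hk.1, hk.2, fun y hpy hyk => ?_, hstep⟩
      simpa [hpy, Option.isSome_iff_ne_none] using hmin y hyk

lemma exists_isSome_of_isSome_mvpStep (st : Fin n → Option (Fin n)) (c p : Fin n) :
    ∃ q, ∀ s, (mvpStep st c p s).isSome → s = q ∨ (st s).isSome := by
  rcases mvpStep_cases st c p with ⟨-, h⟩ | ⟨j, -, -, h⟩ | ⟨j, k, hp, -, -, -, h⟩ <;> rw [h]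
  · exact ⟨p, fun s => by by_cases h : s = p <;> simp [h]⟩
  · exact ⟨p, fun s => by by_cases h : s = p <;> simp [h]⟩
  · refine ⟨k, fun s => ?_⟩
    by_cases h : s = k
    · simp [h]
    · by_cases h' : s = p <;> simp_all

lemma card_isSome_mvpStep_le (st : Fin n → Option (Fin n)) (c p : Fin n) :
    #{s | (mvpStep st c p s).isSome} ≤ #{s | (st s).isSome} + 1 := by
  obtain ⟨q, hq⟩ := exists_isSome_of_isSome_mvpStep st c p
  refine (card_le_card fun s hs => ?_).trans (card_insert_le q {s | (st s).isSome})
  simpa using hq s (by simpa using hs)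

/-- While spot `n` of the circle stays empty, the MVP rule and circular parking occupy the same
spots, and nobody is lost; when spot `n` gets occupied, the MVP rule occupies no new spot. -/
lemma mvpStep_spec (hlast : Fin.last n ∉ T) (hT : ∀ s, (st s).isSome ↔ s.castSucc ∈ T) :
    (Fin.last n ∉ circStep T p.castSucc ∧
      (∀ s, (mvpStep st c p s).isSome ↔ s.castSucc ∈ circStep T p.castSucc) ∧
      (∃ s, mvpStep st c p s = some c) ∧
      ∀ j s, st s = some j → ∃ s', mvpStep st c p s' = some j) ∨
    (Fin.last n ∈ circStep T p.castSucc ∧ ∀ s, (mvpStep st c p s).isSome ↔ (st s).isSome) := by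
  rcases mvpStep_cases st c p with
    ⟨hp, hstep⟩ | ⟨i, hp, hocc, hstep⟩ | ⟨i, k, hp, hpk, hkn, hocc, hstep⟩ <;> rw [hstep]
  · left
    have hpT : p.castSucc ∉ T := by simp [← hT, hp]
    rw [circStep_eq_insert le_rfl hpT fun x h h' => absurd h (not_le.2 h')]
    refine ⟨by simp [hlast, (Fin.castSucc_lt_last p).ne'], fun s => ?_, ⟨p, by simp⟩,
      fun j s hs => ⟨s, ?_⟩⟩
    · by_cases h : s = p
      · simp [h]
      · simp [h, hT]
    · rw [Function.update_of_ne, hs]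
      rintro rfl
      simp [hp] at hs
  · right
    rw [circStep_eq_insert (Fin.le_last _) hlast]
    · refine ⟨mem_insert_self _ _, fun s => ?_⟩
      by_cases h : s = p <;> simp [h, hp]
    · intro x hx hxl
      obtain ⟨y, rfl⟩ := Fin.exists_castSucc_eq.2 hxl.ne
      rw [← hT]
      rcases (Fin.castSucc_le_castSucc_iff.1 hx).eq_or_lt with rfl | hy
      · simp [hp]
      · exact hocc y hy
  · left
    have hpT : p.castSucc ∈ T := by simp [← hT, hp]
    rw [circStep_eq_insert (q := k.castSucc) (Fin.castSucc_le_castSucc_iff.2 hpk.le)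
      (by simp [← hT, hkn])]
    · refine ⟨by simp [hlast, (Fin.castSucc_lt_last k).ne'], fun s => ?_,
        ⟨p, by simp [hpk.ne]⟩, fun j s hs => ?_⟩
      · by_cases h : s = k
        · simp [h]
        · by_cases h' : s = p <;> simp [h, h', hT, hpT, hpk.ne]
      · by_cases h : s = p
        · exact ⟨k, by simp_all⟩
        · refine ⟨s, ?_⟩
          have : s ≠ k := by
            rintro rfl
            simp [hkn] at hs
          simp [h, this, hs]
    · intro x hx hxl
      obtain ⟨y, rfl⟩ := Fin.exists_castSucc_eq.2 (hxl.trans (Fin.castSucc_lt_last k)).ne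
      rcases (Fin.castSucc_le_castSucc_iff.1 hx).eq_or_lt with rfl | hy
      · exact hpT
      · exact (hT y).1 (hocc y hy (Fin.castSucc_lt_castSucc_iff.1 hxl))

lemma foldl_mvpStep_spec (α : Fin n → Fin n) (l : List (Fin n)) :
    #{s | (l.foldl (fun st c => mvpStep st c (α c)) (fun _ => none) s).isSome} ≤ l.length ∧
    ((Fin.last n ∉ circRun (l.map fun c => (α c).castSucc) ∧
      (∀ s, (l.foldl (fun st c => mvpStep st c (α c)) (fun _ => none) s).isSome ↔
        s.castSucc ∈ circRun (l.map fun c => (α c).castSucc)) ∧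
      ∀ c ∈ l, ∃ s, l.foldl (fun st c => mvpStep st c (α c)) (fun _ => none) s = some c) ∨
    (Fin.last n ∈ circRun (l.map fun c => (α c).castSucc) ∧
      #{s | (l.foldl (fun st c => mvpStep st c (α c)) (fun _ => none) s).isSome} <
        l.length)) := by
  induction l using List.reverseRecOn with
  | nil => simp [circRun]
  | append_singleton l c ih =>
    rw [List.map_append, List.map_singleton, circRun_concat, List.foldl_append,
      List.length_append, List.length_singleton, List.foldl_cons, List.foldl_nil]
    generalize l.foldl (fun st c => mvpStep st c (α c)) (fun _ => none) = st at ih ⊢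
    obtain ⟨hle, ih⟩ := ih
    have hcard := card_isSome_mvpStep_le st c (α c)
    refine ⟨by omega, ?_⟩
    rcases ih with ⟨hlast, hT, hpark⟩ | ⟨hlast, hlt⟩
    · rcases mvpStep_spec (c := c) (p := α c) hlast hT with ⟨h1, h2, h3, h4⟩ | ⟨h1, h2⟩
      · refine .inl ⟨h1, h2, fun d hd => ?_⟩
        rcases List.mem_append.1 hd with hd | hd
        · obtain ⟨s, hs⟩ := hpark d hd
          exact h4 d s hs
        · rwa [List.mem_singleton.1 hd]
      · refine .inr ⟨h1, ?_⟩
        simp only [h2]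
        omega
    · exact .inr ⟨subset_circStep hlast, by omega⟩

lemma isMVP_iff_last_notMem_circRun (α : Fin n → Fin n) :
    IsMVP α ↔ Fin.last n ∉ circRun (List.ofFn fun c => (α c).castSucc) := by
  have h := (foldl_mvpStep_spec α (List.finRange n)).2
  rw [← List.ofFn_eq_map, List.length_finRange] at h
  change (_ ∧ _ ∧ ∀ c ∈ List.finRange n, ∃ s, mvpRun α s = some c) ∨
    (_ ∧ #{s | (mvpRun α s).isSome} < n) at h
  rcases h with ⟨hlast, -, hpark⟩ | ⟨hlast, hlt⟩
  · exact iff_of_true (fun c => hpark c (List.mem_finRange c)) hlast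
  · refine iff_of_false (fun hα => hlt.not_ge ?_) (not_not.2 hlast)
    choose f hf using hα
    have hinj : Function.Injective f := fun c d hcd => by
      have := hf c
      rw [hcd, hf d] at this
      exact (Option.some.inj this).symm
    calc n = #(univ.image f) := by rw [card_image_of_injective _ hinj, card_fin]
      _ ≤ _ := card_le_card fun s hs => by
        obtain ⟨c, -, rfl⟩ := mem_image.1 hs
        simp [hf c]

end Linear

lemma card_isMVP_eq (n : ℕ) :
    Nat.card {α : Fin n → Fin n // IsMVP α} =
      #{β : Fin n → Fin (n + 1) | Fin.last n ∉ circRun (List.ofFn β)} := by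
  rw [← Nat.card_eq_finsetCard]
  refine Nat.card_eq_of_bijective
    (fun α => ⟨fun c => (α.1 c).castSucc, by
      simpa using (isMVP_iff_last_notMem_circRun α.1).1 α.2⟩) ⟨fun α α' h => ?_, ?_⟩
  · ext1
    funext c
    exact Fin.castSucc_injective n (congrFun (congrArg Subtype.val h) c)
  · rintro ⟨β, hβ⟩
    rw [mem_filter_univ] at hβ
    have hne (c : Fin n) : β c ≠ Fin.last n := fun hc =>
      hβ (mem_circRun_of_mem (List.mem_ofFn.2 ⟨c, hc⟩))
    refine ⟨⟨fun c => (β c).castPred (hne c), ?_⟩, ?_⟩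
    · simpa [isMVP_iff_last_notMem_circRun] using hβ
    · simp

end MVPPark

open MVPPark in
/-- The number of MVP parking functions of length `n` is `(n+1)^(n-1)`. -/
theorem card_mvp (n : ℕ) (hn : 1 ≤ n) :
    Nat.card {α : Fin n → Fin n // IsMVP α} = (n + 1) ^ (n - 1) := by
  have h := card_last_notMem_circRun n
  rw [← card_isMVP_eq] at h
  obtain ⟨m, rfl⟩ := Nat.exists_eq_add_of_le' hn
  rw [pow_succ'] at h
  exact Nat.eq_of_mul_eq_mul_left (Nat.succ_pos _) h
end

section
/- Let n ≥ 1 and let π ∈ S_n be an involution (π ∘ π = identity), regarded as the preference list in which car i prefers spot π_i. Then π is an MVP parking function and O_n(π) = π. -/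
open Finset

namespace MVPPark

theorem mvpStep_of_none {n : ℕ} {state : Fin n → Option (Fin n)} {c p : Fin n}
    (h : state p = none) : mvpStep state c p = Function.update state p (some c) := by
  simp [mvpStep, h]

/-- Cars with distinct preferences that find their preferred spots empty park there without
bumping anyone. -/
theorem foldl_mvpStep_of_injective {n : ℕ} {α : Fin n → Fin n} (hα : Function.Injective α)
    (l : List (Fin n)) (hl : l.Nodup) (state : Fin n → Option (Fin n))
    (hstate : ∀ c ∈ l, state (α c) = none) (c : Fin n) :
    l.foldl (fun st c => mvpStep st c (α c)) state (α c) =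
      if c ∈ l then some c else state (α c) := by
  induction l generalizing state with
  | nil => simp
  | cons a l ih =>
    obtain ⟨ha, hl⟩ := List.nodup_cons.mp hl
    rw [List.foldl_cons, mvpStep_of_none (hstate a List.mem_cons_self), ih hl]
    · by_cases hc : c = a
      · subst hc
        simp [ha]
      · simp [hc, hα.ne hc]
    · intro b hb
      have hba : b ≠ a := fun h => ha (h ▸ hb)
      rw [Function.update_of_ne (hα.ne hba)]
      exact hstate b (List.mem_cons_of_mem a hb)

theorem mvpRun_apply_of_injective {n : ℕ} {α : Fin n → Fin n} (hα : Function.Injective α)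
    (c : Fin n) : mvpRun α (α c) = some c := by
  rw [mvpRun, foldl_mvpStep_of_injective hα _ (List.nodup_finRange n) _ (fun _ _ => rfl)]
  simp

end MVPPark

open MVPPark in
/-- An involution `π`, regarded as a preference list, is an MVP parking function with
outcome `π`. -/
theorem outcome_of_involution (n : ℕ) (hn : 1 ≤ n) (π : Equiv.Perm (Fin n))
    (hπ : ∀ x : Fin n, π (π x) = x) :
    IsMVP (⇑π) ∧ MvpOutcome (⇑π) π := by
  refine ⟨fun c => ⟨π c, mvpRun_apply_of_injective π.injective c⟩, fun j => ?_⟩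
  simpa only [hπ] using mvpRun_apply_of_injective π.injective (π j)
end

section
/- Let n ≥ 1, let π ∈ S_n, and let α = (a_1,…,a_n) ∈ [n]^n be a preference list such that for every j ∈ [n] the preference of car π_j lies in Ω_j(π) (that is, a_{π_j} ∈ Ω_j(π) for all j). If for some i ∈ [n] car π_i prefers spot i (a_{π_i} = i), then under the MVP parking rule car π_i ends parked in spot i. -/
open Finset

namespace MVPPark

/-- `C_j(π)`: the set of cars arriving after car `π j` that park to the left of
spot `j`, together with car `π j` itself. -/
def Cset {n : ℕ} (π : Equiv.Perm (Fin n)) (j : Fin n) : Finset (Fin n) :=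
  ((Finset.univ.filter (fun k => k < j)).image π ∩
      Finset.univ.filter (fun c => π j < c)) ∪ {π j}

/-- `Ω_j(π)`: the set of spots on or to the left of spot `j` occupied (in the outcome
`π`) by a car of `C_j(π)`. -/
def Omega {n : ℕ} (π : Equiv.Perm (Fin n)) (j : Fin n) : Finset (Fin n) :=
  Finset.univ.filter (fun k => k ≤ j ∧ π k ∈ Cset π j)

end MVPPark

namespace MVPPark

/-- An arriving car parks in its preferred spot. -/
theorem mvpStep_apply_self {n : ℕ} (st : Fin n → Option (Fin n)) (c p : Fin n) :
    mvpStep st c p p = some c := by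
  rcases hp : st p with _ | j
  · simp [mvpStep, hp]
  rcases hk : (List.finRange n).find? (fun k => decide (p < k) && (st k).isNone) with _ | k
  · simp only [mvpStep, hp, hk, Function.update_self]
  · have hpk := List.find?_some hk
    simp only [Bool.and_eq_true, decide_eq_true_eq] at hpk
    simp only [mvpStep, hp, hk, Function.update_of_ne hpk.1.ne, Function.update_self]

/-- A parked car stays in its spot when the arriving car prefers a different spot. -/
theorem mvpStep_apply_of_ne {n : ℕ} {st : Fin n → Option (Fin n)} {c d p i : Fin n}
    (hi : st i = some d) (hpi : p ≠ i) : mvpStep st c p i = some d := by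
  rcases hp : st p with _ | j
  · simp only [mvpStep, hp, Function.update_of_ne hpi.symm, hi]
  rcases hk : (List.finRange n).find? (fun k => decide (p < k) && (st k).isNone) with _ | k
  · simp only [mvpStep, hp, hk, Function.update_of_ne hpi.symm, hi]
  · have hik : i ≠ k := by
      rintro rfl
      simpa [hi] using List.find?_some hk
    simp only [mvpStep, hp, hk, Function.update_of_ne hik, Function.update_of_ne hpi.symm, hi]

/-- A parked car keeps its spot while no arriving car prefers that spot. -/
theorem foldl_mvpStep_apply_of_ne {n : ℕ} (α : Fin n → Fin n) {d i : Fin n}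
    (l : List (Fin n)) (st : Fin n → Option (Fin n)) (hi : st i = some d)
    (hl : ∀ c ∈ l, α c ≠ i) :
    l.foldl (fun st c => mvpStep st c (α c)) st i = some d := by
  induction l generalizing st with
  | nil => exact hi
  | cons a l ih =>
    exact ih _ (mvpStep_apply_of_ne hi (hl a (by simp))) fun c hc => hl c (by simp [hc])

/-- If no car arriving after `d` shares the preference of `d`, then `d` ends up parked in its
preferred spot. -/
theorem mvpRun_apply_of_forall_gt {n : ℕ} (α : Fin n → Fin n) (d : Fin n)
    (hd : ∀ c, d < c → α c ≠ α d) : mvpRun α (α d) = some d := by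
  obtain ⟨s, t, hst⟩ := List.append_of_mem (List.mem_finRange d)
  have hsorted : (s ++ d :: t).Pairwise (· < ·) := hst ▸ List.pairwise_lt_finRange n
  have ht : ∀ c ∈ t, d < c :=
    (List.pairwise_cons.1 (List.pairwise_append.1 hsorted).2.1).1
  rw [mvpRun, hst, List.foldl_append, List.foldl_cons]
  exact foldl_mvpStep_apply_of_ne α t _ (mvpStep_apply_self _ _ _) fun c hc => hd c (ht c hc)

/-- A spot in `Ω_j(π)` is assigned by `π` to a car arriving no earlier than `π j`. -/
theorem le_of_mem_Omega {n : ℕ} {π : Equiv.Perm (Fin n)} {j k : Fin n}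
    (hk : k ∈ Omega π j) : π j ≤ π k := by
  simp only [Omega, Cset, Finset.mem_filter, Finset.mem_union, Finset.mem_inter,
    Finset.mem_singleton] at hk
  rcases hk.2.2 with h | h
  · exact h.2.2.le
  · exact h.ge

end MVPPark

open MVPPark in
/-- If every car `π j` prefers a spot in `Ω_j(π)` and car `π i` prefers spot `i`, then
under the MVP rule car `π i` ends parked in spot `i`. -/
theorem trivial_pref_parks (n : ℕ) (hn : 1 ≤ n) (π : Equiv.Perm (Fin n))
    (α : Fin n → Fin n) (hα : ∀ j : Fin n, α (π j) ∈ Omega π j)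
    (i : Fin n) (hi : α (π i) = i) :
    mvpRun α i = some (π i) := by
  have h : mvpRun α (α (π i)) = some (π i) := by
    refine mvpRun_apply_of_forall_gt α (π i) fun c hc hci => ?_
    have hmem := hα (π.symm c)
    rw [π.apply_symm_apply, hci, hi] at hmem
    have hle := le_of_mem_Omega hmem
    rw [π.apply_symm_apply] at hle
    exact absurd hc hle.not_gt
  rwa [hi] at h
end

section
/- Let n ≥ 1, k ≥ 1 and b with 2 ≤ b ≤ n and k ≤ b, and let π ∈ S_n be the decreasing k-cycle ⟨b, b−1, …, b−k+1⟩, i.e., in one-line notation π_j = j for j ≤ b−k or j > b, π_{b−k+1} = b, and π_j = j−1 for b−k+2 ≤ j ≤ b. Then the fiber of the MVP outcome map over π has exactly 2^(k−1) elements: |O_n^{-1}(π)| = 2^(k−1). -/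
open Finset

namespace MVPPark

/-- The state of the MVP parking process with preference list `α` after the first `c` cars. -/
def mvpState {n : ℕ} (α : Fin n → Fin n) : ℕ → Fin n → Option (Fin n)
  | 0 => fun _ => none
  | c + 1 => if h : c < n then mvpStep (mvpState α c) ⟨c, h⟩ (α ⟨c, h⟩) else mvpState α c

theorem mvpState_succ {n : ℕ} (α : Fin n → Fin n) (c : Fin n) :
    mvpState α (c.1 + 1) = mvpStep (mvpState α c.1) c (α c) := by
  simp [mvpState]

theorem mvpRun_eq_mvpState {n : ℕ} (α : Fin n → Fin n) : mvpRun α = mvpState α n := by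
  have key : ∀ c ≤ n, mvpState α c = ((List.finRange n).take c).foldl
      (fun st c => mvpStep st c (α c)) (fun _ => none) := by
    intro c
    induction c with
    | zero => intro _; rfl
    | succ c ih =>
      intro hc
      have hlen : c < (List.finRange n).length := by simpa using hc
      rw [List.take_add_one, List.getElem?_eq_getElem hlen, mvpState_succ α ⟨c, hc⟩,
        ih (by omega)]
      simp
  rw [key n le_rfl, List.take_of_length_le (by simp)]
  rfl

theorem mvpStep_of_eq_none {n : ℕ} {st : Fin n → Option (Fin n)} {c p : Fin n}
    (h : st p = none) : mvpStep st c p = Function.update st p (some c) := by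
  simp [mvpStep, h]

theorem mvpStep_of_eq_some {n : ℕ} {st : Fin n → Option (Fin n)} {c p x : Fin n}
    (h : st p = some x) :
    ((∀ k, p < k → st k ≠ none) ∧ mvpStep st c p = Function.update st p (some c)) ∨
    ∃ k, p < k ∧ st k = none ∧ (∀ l, p < l → l < k → st l ≠ none) ∧
      mvpStep st c p = Function.update (Function.update st p (some c)) k (some x) := by
  rcases hf : (List.finRange n).find? (fun k => decide (p < k) && (st k).isNone) with _ | k
  · left
    refine ⟨fun k hk => ?_, by simp [mvpStep, h, hf]⟩
    simpa [hk] using List.find?_eq_none.1 hf k (List.mem_finRange k)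
  · right
    obtain ⟨hk, i, hi, hik, hmin⟩ := List.find?_eq_some_iff_getElem.1 hf
    simp only [List.getElem_finRange, Bool.and_eq_true, decide_eq_true_eq,
      Option.isNone_iff_eq_none] at hk hik
    refine ⟨k, hk.1, hk.2, fun l hl hlk => ?_, by simp [mvpStep, h, hf]⟩
    have := hmin l.1 (by subst hik; exact hlk)
    simpa [hl, Option.isSome_iff_ne_none] using this

/-- In every state, only cars that have already arrived are parked, each in at most one spot. -/
theorem mvpState_wf {n : ℕ} (α : Fin n → Fin n) (c : ℕ) (hc : c ≤ n) :
    (∀ s x, mvpState α c s = some x → x.1 < c) ∧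
    (∀ s s' x, mvpState α c s = some x → mvpState α c s' = some x → s = s') := by
  induction c with
  | zero => simp [mvpState]
  | succ c ih =>
    obtain ⟨h1, h2⟩ := ih (by omega)
    have hs := mvpState_succ α ⟨c, hc⟩
    simp only at hs
    generalize mvpState α c = st at *
    generalize mvpState α (c + 1) = st' at *
    generalize α ⟨c, hc⟩ = p at *
    have hcc : (⟨c, hc⟩ : Fin n).1 = c := rfl
    generalize (⟨c, hc⟩ : Fin n) = C at *
    rcases hp : st p with _ | x
    · rw [mvpStep_of_eq_none hp] at hs
      subst hs
      simp only [Function.update_apply]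
      constructor <;> grind
    · rcases mvpStep_of_eq_some (c := C) hp with ⟨-, h⟩ | ⟨k, hk, hk0, -, h⟩ <;>
      · rw [h] at hs
        subst hs
        simp only [Function.update_apply]
        constructor <;> grind

/-- If the outcome is `π`, then in every state all arrived cars are parked, and a car not yet in
its final spot sits before that spot, which is still empty. -/
theorem mvpState_of_mvpOutcome {n : ℕ} {α : Fin n → Fin n} {π : Equiv.Perm (Fin n)}
    (h : MvpOutcome α π) (c : ℕ) (hc : c ≤ n) :
    (∀ x : Fin n, x.1 < c → ∃ s, mvpState α c s = some x) ∧
    (∀ s x, mvpState α c s = some x →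
      s = π.symm x ∨ (s < π.symm x ∧ mvpState α c (π.symm x) = none)) := by
  induction hc using Nat.decreasingInduction with
  | self =>
    rw [← mvpRun_eq_mvpState]
    refine ⟨fun x _ => ⟨π.symm x, by simpa using h (π.symm x)⟩, fun s x hs => Or.inl ?_⟩
    rw [h s, Option.some_inj] at hs
    simp [← hs]
  | of_succ c hc ih =>
    obtain ⟨h1, h2⟩ := ih
    obtain ⟨w1, w2⟩ := mvpState_wf α c hc.le
    have hs := mvpState_succ α ⟨c, hc⟩
    simp only at hs
    generalize mvpState α c = st at *
    generalize mvpState α (c + 1) = st' at *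
    generalize α ⟨c, hc⟩ = p at *
    have hcc : (⟨c, hc⟩ : Fin n).1 = c := rfl
    generalize (⟨c, hc⟩ : Fin n) = C at *
    rcases hp : st p with _ | y
    · rw [mvpStep_of_eq_none hp] at hs
      subst hs
      simp only [Function.update_apply] at h1 h2
      constructor <;> grind
    · rcases mvpStep_of_eq_some (c := C) hp with ⟨-, h⟩ | ⟨k, hk, hk0, -, h⟩
      · rw [h] at hs
        subst hs
        simp only [Function.update_apply] at h1 h2
        obtain ⟨s, hs⟩ := h1 y (by have := w1 p y hp; omega)
        grind
      · rw [h] at hs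
        subst hs
        simp only [Function.update_apply] at h1 h2
        constructor
        · intro x hx
          obtain ⟨s, hs⟩ := h1 x (by omega)
          grind
        · intro s x hsx
          by_cases hsp : s = p
          · have := h2 k x (by grind)
            grind
          · have := h2 s x (by grind)
            grind

theorem mvpState_succ_apply_self {n : ℕ} (α : Fin n → Fin n) (c : Fin n) :
    mvpState α (c.1 + 1) (α c) = some c := by
  rw [mvpState_succ]
  rcases hp : mvpState α c.1 (α c) with _ | y
  · simp [mvpStep_of_eq_none hp]
  · rcases mvpStep_of_eq_some (c := c) hp with ⟨-, h⟩ | ⟨k, hk, -, -, h⟩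
    · simp [h]
    · simp [h, Function.update_of_ne hk.ne]

/-- A car preferring a spot other than its final one prefers an earlier spot, whose final occupant
arrives later. -/
theorem MvpOutcome.apply_eq_or {n : ℕ} {α : Fin n → Fin n} {π : Equiv.Perm (Fin n)}
    (h : MvpOutcome α π) (c : Fin n) :
    α c = π.symm c ∨ (α c < π.symm c ∧ c < π (α c)) := by
  obtain ⟨h1, h2⟩ := mvpState_of_mvpOutcome h (c.1 + 1) c.2
  have hself := mvpState_succ_apply_self α c
  rcases h2 _ _ hself with h3 | ⟨h3, -⟩
  · exact Or.inl h3
  · refine Or.inr ⟨h3, ?_⟩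
    by_contra hlt
    obtain ⟨s, hs⟩ := h1 (π (α c)) (by rw [not_lt] at hlt; exact Nat.lt_succ_of_le hlt)
    have h4 := h2 s _ hs
    rw [Equiv.symm_apply_apply] at h4
    rcases h4 with rfl | ⟨-, h4⟩
    · rw [hself, Option.some_inj] at hs
      exact h3.ne ((Equiv.eq_symm_apply π).2 hs.symm)
    · simp [hself] at h4

/-- A sufficient condition for the outcome to be `π`: every car prefers its final spot or the spot
`M`, and whenever a car is bumped from `M`, the spots before its final one are filled. -/
theorem mvpOutcome_of_forall {n : ℕ} {α : Fin n → Fin n} {π : Equiv.Perm (Fin n)} {M : Fin n}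
    (hM : ∀ c, M < π.symm c → c < π M → ∀ j, M < j → j < π.symm c → π j < c)
    (hα : ∀ c, α c = π.symm c ∨ (α c = M ∧ M < π.symm c ∧ c < π M)) :
    MvpOutcome α π := by
  have key : ∀ c ≤ n,
      (∀ s x, mvpState α c s = some x →
        s = π.symm x ∨ (s = M ∧ M < π.symm x ∧ x < π M)) ∧
      (∀ x : Fin n, x.1 < c →
        mvpState α c (π.symm x) = some x ∨ mvpState α c M = some x) := by
    intro c hc
    induction c with
    | zero => simp [mvpState]
    | succ c ih =>
      obtain ⟨h1, h2⟩ := ih (by omega)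
      obtain ⟨w1, w2⟩ := mvpState_wf α c (by omega)
      have hs := mvpState_succ α ⟨c, hc⟩
      have ha := hα ⟨c, hc⟩
      simp only at hs
      generalize mvpState α c = st at *
      generalize mvpState α (c + 1) = st' at *
      generalize α ⟨c, hc⟩ = p at *
      have hcc : (⟨c, hc⟩ : Fin n).1 = c := rfl
      generalize (⟨c, hc⟩ : Fin n) = C at *
      clear ih hα
      rcases hp : st p with _ | t
      · rw [mvpStep_of_eq_none hp] at hs
        subst hs
        simp only [Function.update_apply]
        clear hM
        constructor
        · intro s x hsx
          by_cases hsp : s = p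
          · grind
          · exact h1 s x (by simpa [hsp] using hsx)
        · intro x hx
          by_cases hxC : x = C
          · grind
          · have := h2 x (by omega)
            grind
      · have ht := w1 p t hp
        have htC : t ≠ C := by rintro rfl; omega
        obtain ⟨hpM, hMt, htM⟩ : p = M ∧ M < π.symm t ∧ t < π M := by
          rcases h1 p t hp with h | h
          · rcases ha with ha | ⟨ha, -, hCM⟩
            · exact absurd (π.symm.injective (h.symm.trans ha)) htC
            · have htM : t = π M := by rw [← ha, h, Equiv.apply_symm_apply]
              subst htM
              rw [Fin.lt_def] at hCM
              omega
          · exact h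
        subst hpM
        have hqt : st (π.symm t) = none := by
          by_contra hne
          obtain ⟨y, hy⟩ := Option.ne_none_iff_exists'.1 hne
          rcases h1 _ _ hy with h | h
          · have hty : t = y := π.symm.injective h
            subst hty
            exact hMt.ne (w2 _ _ _ hp hy)
          · exact hMt.ne h.1.symm
        have hfill : ∀ j, p < j → j < π.symm t → st j ≠ none := by
          intro j hj hjt
          have hlt := hM t hMt htM j hj hjt
          rcases h2 (π j) (by rw [Fin.lt_def] at hlt; omega) with h | h
          · simp_all
          · rw [hp, Option.some_inj] at h
            exact absurd h.symm hlt.ne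
        rcases mvpStep_of_eq_some (c := C) hp with ⟨h, -⟩ | ⟨k, hk, hk0, hkm, h⟩
        · exact absurd hqt (h _ hMt)
        · have hkt : k = π.symm t := by
            rcases lt_trichotomy k (π.symm t) with h | h | h
            · exact absurd hk0 (hfill k hk h)
            · exact h
            · exact absurd hqt (hkm _ hMt h)
          rw [h] at hs
          subst hs
          simp only [Function.update_apply]
          clear hM hfill hkm
          constructor
          · intro s x hsx
            by_cases hsp : s = p
            · grind
            · by_cases hsk : s = k
              · grind
              · exact h1 s x (by simpa [hsp, hsk] using hsx)
          · intro x hx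
            by_cases hxC : x = C
            · grind
            · have := h2 x (by omega)
              grind
  obtain ⟨h1, h2⟩ := key n le_rfl
  rw [← mvpRun_eq_mvpState] at h1 h2
  intro j
  rcases h2 (π j) (π j).2 with h | h
  · simpa using h
  · have hM' := h2 (π M) (π M).2
    rw [Equiv.symm_apply_apply, or_self, h, Option.some_inj] at hM'
    rw [← π.injective hM'] at h
    exact h

end MVPPark

open MVPPark in
/-- If `π` is the decreasing `k`-cycle `⟨b, b-1, …, b-k+1⟩` (described in one-line
notation, with spots and cars numbered `1, …, n` via `j ↦ j.1 + 1`), then the fiber of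
the MVP outcome map over `π` has exactly `2^(k-1)` elements. -/
theorem fiber_decreasing_cycle (n b k : ℕ) (hn : 1 ≤ n) (hb : 2 ≤ b) (hbn : b ≤ n)
    (hk : 1 ≤ k) (hkb : k ≤ b) (π : Equiv.Perm (Fin n))
    (hfix : ∀ j : Fin n, (j.1 + 1 ≤ b - k ∨ b < j.1 + 1) → π j = j)
    (htop : ∀ j : Fin n, j.1 + 1 = b - k + 1 → (π j).1 + 1 = b)
    (hdown : ∀ j : Fin n, b - k + 2 ≤ j.1 + 1 → j.1 + 1 ≤ b → (π j).1 + 1 = j.1) :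
    Nat.card {α : Fin n → Fin n // MvpOutcome α π} = 2 ^ (k - 1) := by
  set M : Fin n := ⟨b - k, by omega⟩
  have hπM : (π M).1 + 1 = b := htop M rfl
  have hlow : ∀ c : Fin n, c.1 < b - k ∨ b ≤ c.1 → π.symm c = c := by
    intro c hc
    rw [Equiv.symm_apply_eq, hfix c (by omega)]
  have hmid : ∀ c : Fin n, b - k ≤ c.1 → c.1 + 1 < b → (π.symm c).1 = c.1 + 1 := by
    intro c h1 h2
    have h3 := hdown ⟨c.1 + 1, by omega⟩ (by simp only; omega) (by simp only; omega)
    have h4 : π.symm c = ⟨c.1 + 1, by omega⟩ := by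
      rw [Equiv.symm_apply_eq, Fin.ext_iff]
      simp only at h3
      omega
    rw [h4]
  have hlast : ∀ c : Fin n, c.1 + 1 = b → π.symm c = M := by
    intro c hc
    rw [Equiv.symm_apply_eq, Fin.ext_iff]
    omega
  have hcond : ∀ c : Fin n, (M < π.symm c ∧ c < π M) ↔ (b - k ≤ c.1 ∧ c.1 + 1 < b) := by
    intro c
    have hMv : M.1 = b - k := rfl
    rw [Fin.lt_def, Fin.lt_def]
    constructor
    · rintro ⟨h1, h2⟩
      refine ⟨?_, by omega⟩
      by_contra h3
      rw [hlow c (by omega)] at h1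
      omega
    · rintro ⟨h1, h2⟩
      have := hmid c h1 h2
      omega
  have hiff : ∀ α : Fin n → Fin n, MvpOutcome α π ↔
      ∀ c, α c = π.symm c ∨ (α c = M ∧ b - k ≤ c.1 ∧ c.1 + 1 < b) := by
    intro α
    constructor
    · intro h c
      rcases h.apply_eq_or c with h1 | ⟨h1, h2⟩
      · exact Or.inl h1
      right
      have hMv : M.1 = b - k := rfl
      rw [Fin.lt_def] at h1 h2
      have hq : (π.symm c).1 ≤ c.1 + 1 ∧ (b ≤ c.1 + 1 → (π.symm c).1 ≤ c.1) := by
        by_cases hc : c.1 < b - k ∨ b ≤ c.1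
        · rw [hlow c hc]
          omega
        · by_cases hcb : c.1 + 1 = b
          · rw [hlast c hcb]
            omega
          · have := hmid c (by omega) (by omega)
            omega
      have hp : (α c).1 = b - k := by
        by_contra hne
        by_cases hpm : (α c).1 + 1 ≤ b - k ∨ b < (α c).1 + 1
        · rw [hfix _ hpm] at h2
          by_cases hc : c.1 < b - k ∨ b ≤ c.1
          · rw [hlow c hc] at h1
            omega
          · omega
        · have h3 := hdown (α c) (by omega) (by omega)
          omega
      have hpM : α c = M := Fin.ext hp
      rw [hpM] at h1 h2
      exact ⟨hpM, (hcond c).1 ⟨h1, h2⟩⟩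
    · intro h
      refine mvpOutcome_of_forall (M := M) (fun c h1 h2 j hj hjc => ?_) (fun c => ?_)
      · obtain ⟨h3, h4⟩ := (hcond c).1 ⟨h1, h2⟩
        have h5 := hmid c h3 h4
        have hMv : M.1 = b - k := rfl
        rw [Fin.lt_def] at hj hjc ⊢
        have h6 := hdown j (by omega) (by omega)
        omega
      · rw [hcond c]
        exact h c
  have hset : {α : Fin n → Fin n | MvpOutcome α π} = Fintype.piFinset fun c : Fin n =>
      if b - k ≤ c.1 ∧ c.1 + 1 < b then {π.symm c, M} else ({π.symm c} : Finset (Fin n)) := by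
    ext α
    simp only [Set.mem_ofPred_eq, hiff, Finset.mem_coe, Fintype.mem_piFinset]
    refine forall_congr' fun c => ?_
    split_ifs with hc
    · simp [hc.1, hc.2]
    · simp only [hc, and_false, or_false, Finset.mem_singleton]
  have hcard : ∀ c : Fin n, (if b - k ≤ c.1 ∧ c.1 + 1 < b then {π.symm c, M}
      else ({π.symm c} : Finset (Fin n))).card =
      if b - k ≤ c.1 ∧ c.1 + 1 < b then 2 else 1 := by
    intro c
    split_ifs with hc
    · exact Finset.card_pair ((hcond c).2 hc).1.ne'
    · simp
  have hcount : #{c : Fin n | b - k ≤ c.1 ∧ c.1 + 1 < b} = k - 1 := by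
    have : ({c : Fin n | b - k ≤ c.1 ∧ c.1 + 1 < b} : Finset (Fin n)).map Fin.valEmbedding =
        Finset.Ico (b - k) (b - 1) := by
      ext i
      simp only [Finset.mem_map, Finset.mem_filter, Finset.mem_univ, true_and,
        Fin.valEmbedding_apply, Finset.mem_Ico]
      constructor
      · rintro ⟨c, hc, rfl⟩
        omega
      · intro hi
        exact ⟨⟨i, by omega⟩, by simp only; omega, rfl⟩
    rw [← Finset.card_map Fin.valEmbedding, this, Nat.card_Ico]
    omega
  change Nat.card ({α : Fin n → Fin n | MvpOutcome α π} : Set _) = _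
  rw [hset, Nat.card_coe_set_eq, Set.ncard_coe_finset, Fintype.card_piFinset,
    Finset.prod_congr rfl fun c _ => hcard c, Finset.prod_ite, Finset.prod_const, hcount, Finset.prod_const, one_pow, mul_one]
end
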